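/- arXiv:math/0603488 — 2 statements merged into one kernel-verified Lean document; each statement's English description precedes it below -/
import Mathlib

section
/- For every prime p ≥ 5, Σ_{1 ≤ i < j < k ≤ p-1, k even} 1/(ijk) ≡ -(1/6) q_2(p)^3 - (7/48) B_{p-3} (mod p), as a congruence of p-integral rationals. -/
namespace TS
open Finset

section gen
variable {R : Type*} [CommRing R]

def S (n : ℕ) (f : ℕ → R) : R := ∑ k ∈ range n, f k
def D (n : ℕ) (f g : ℕ → R) : R := ∑ k ∈ range n, S k f * g k
def T (n : ℕ) (f g h : ℕ → R) : R := ∑ k ∈ range n, D k f g * h k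

lemma S_succ (n : ℕ) (f : ℕ → R) : S (n+1) f = S n f + f n := sum_range_succ _ _
lemma D_succ (n : ℕ) (f g : ℕ → R) : D (n+1) f g = D n f g + S n f * g n := sum_range_succ _ _
lemma T_succ (n : ℕ) (f g h : ℕ → R) : T (n+1) f g h = T n f g h + D n f g * h n :=
  sum_range_succ _ _
lemma S_zero (f : ℕ → R) : S 0 f = 0 := rfl
lemma D_zero (f g : ℕ → R) : D 0 f g = 0 := rfl
lemma T_zero (f g h : ℕ → R) : T 0 f g h = 0 := rfl

lemma stuffle2 (n : ℕ) (f g : ℕ → R) :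
    S n f * S n g = D n f g + D n g f + S n (fun k => f k * g k) := by
  induction n with
  | zero => simp [S_zero, D_zero]
  | succ n ih => simp only [S_succ, D_succ]; linear_combination ih

lemma stuffle3 (n : ℕ) (a f g : ℕ → R) :
    S n a * D n f g = T n a f g + D n (fun k => a k * f k) g + T n f a g
      + D n f (fun k => a k * g k) + T n f g a := by
  induction n with
  | zero => simp [S_zero, D_zero, T_zero]
  | succ n ih =>
    have h2 := stuffle2 n a f
    simp only [S_succ, D_succ, T_succ]; linear_combination ih + g n * h2

lemma D_eq (n : ℕ) (f g : ℕ → R) :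
    D n f g = ∑ x ∈ (range n).sigma (fun k => range k), f x.2 * g x.1 := by
  simp only [D, S, sum_sigma, sum_mul]

lemma T_eq (n : ℕ) (f g h : ℕ → R) :
    T n f g h = ∑ x ∈ ((range n).sigma (fun k => range k)).sigma (fun y => range y.2),
      f x.2 * g x.1.2 * h x.1.1 := by
  simp only [T, D, S, sum_sigma, sum_mul]

lemma D_shift (p : ℕ) (f g : ℕ → R) :
    D p f g = ∑ k ∈ range p, ∑ j ∈ range k, f j * g (p - (k - j)) := by
  rw [D_eq, sum_sigma']
  refine sum_nbij' (fun x => ⟨p - (x.1 - x.2), x.2⟩) (fun x => ⟨p - (x.1 - x.2), x.2⟩) ?_ ?_ ?_ ?_ ?_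
  · rintro ⟨k, j⟩ h; simp at h ⊢; omega
  · rintro ⟨k, j⟩ h; simp at h ⊢; omega
  · rintro ⟨k, j⟩ h; simp at h ⊢; omega
  · rintro ⟨k, j⟩ h; simp at h ⊢; omega
  · rintro ⟨k, j⟩ h
    simp at h ⊢
    have : p - (p - (k - j) - j) = k := by omega
    rw [this]

lemma D_rev (p : ℕ) (f g : ℕ → R) :
    D (p+1) f g = D (p+1) (fun k => g (p - k)) (fun k => f (p - k)) := by
  rw [D_eq, D_eq]
  refine sum_nbij' (fun x => ⟨p - x.2, p - x.1⟩) (fun x => ⟨p - x.2, p - x.1⟩) ?_ ?_ ?_ ?_ ?_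
  · rintro ⟨k, j⟩ h; simp at h ⊢; omega
  · rintro ⟨k, j⟩ h; simp at h ⊢; omega
  · rintro ⟨k, j⟩ h; simp at h ⊢; omega
  · rintro ⟨k, j⟩ h; simp at h ⊢; omega
  · rintro ⟨k, j⟩ h
    simp at h ⊢
    rw [Nat.sub_sub_self (by omega), Nat.sub_sub_self (by omega), mul_comm]

lemma T_rev (p : ℕ) (f g h : ℕ → R) :
    T (p+1) f g h = T (p+1) (fun k => h (p - k)) (fun k => g (p - k)) (fun k => f (p - k)) := by
  rw [T_eq, T_eq]
  refine sum_nbij' (fun x => ⟨⟨p - x.2, p - x.1.2⟩, p - x.1.1⟩)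
    (fun x => ⟨⟨p - x.2, p - x.1.2⟩, p - x.1.1⟩) ?_ ?_ ?_ ?_ ?_
  · rintro ⟨⟨k, j⟩, i⟩ h; simp at h ⊢; omega
  · rintro ⟨⟨k, j⟩, i⟩ h; simp at h ⊢; omega
  · rintro ⟨⟨k, j⟩, i⟩ h; simp at h ⊢; omega
  · rintro ⟨⟨k, j⟩, i⟩ h; simp at h ⊢; omega
  · rintro ⟨⟨k, j⟩, i⟩ h
    simp at h ⊢
    rw [Nat.sub_sub_self (by omega), Nat.sub_sub_self (by omega), Nat.sub_sub_self (by omega)]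
    ring

lemma S_congr {n : ℕ} {f f' : ℕ → R} (h : ∀ k < n, f k = f' k) : S n f = S n f' :=
  sum_congr rfl (fun k hk => h k (mem_range.1 hk))
lemma D_congr {n : ℕ} {f f' g g' : ℕ → R} (h : ∀ k < n, f k = f' k) (h' : ∀ k < n, g k = g' k) :
    D n f g = D n f' g' :=
  sum_congr rfl (fun k hk => by
    rw [h' k (mem_range.1 hk), S_congr (fun j hj => h j (hj.trans (mem_range.1 hk)))])
lemma T_congr {n : ℕ} {f f' g g' k k' : ℕ → R} (h : ∀ k < n, f k = f' k) (h' : ∀ k < n, g k = g' k)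
    (h'' : ∀ i < n, k i = k' i) :
    T n f g k = T n f' g' k' :=
  sum_congr rfl (fun i hi => by
    rw [h'' i (mem_range.1 hi), D_congr (fun j hj => h j (hj.trans (mem_range.1 hi)))
      (fun j hj => h' j (hj.trans (mem_range.1 hi)))])
end gen

section modp
variable (p : ℕ) [Fact p.Prime]

def u (k : ℕ) : ZMod p := (k : ZMod p)⁻¹
def v (k : ℕ) : ZMod p := (-1) ^ k * (k : ZMod p)⁻¹

lemma u_zero : u p 0 = 0 := by simp [u]
lemma u_p : u p p = 0 := by simp [u]
lemma v_zero : v p 0 = 0 := by simp [v]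
lemma v_p : v p p = 0 := by simp [v]
lemma v_eq (k : ℕ) : v p k = (-1) ^ k * u p k := rfl
lemma sgn_sq (k : ℕ) : ((-1 : ZMod p) ^ k) * (-1) ^ k = 1 := by
  rw [← mul_pow]; simp
lemma u_rev {k : ℕ} (h : k ≤ p) : u p (p - k) = - u p k := by
  simp [u, Nat.cast_sub h, inv_neg]
lemma sgn_rev (hp : p ≠ 2) {k : ℕ} (h : k ≤ p) : (-1 : ZMod p) ^ (p - k) = - (-1) ^ k := by
  have h1 : (-1 : ZMod p) ^ (p - k) * (-1) ^ k = -1 := by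
    rw [← pow_add, Nat.sub_add_cancel h]
    exact Odd.neg_one_pow ((Fact.out : p.Prime).odd_of_ne_two hp)
  have := sgn_sq p k
  linear_combination (-1)^k * h1 - (-1) ^ (p-k) * this
lemma v_rev (hp : p ≠ 2) {k : ℕ} (h : k ≤ p) : v p (p - k) = v p k := by
  rw [v_eq, v_eq, sgn_rev p hp h, u_rev p h]; ring

lemma u_cancel {k : ℕ} (h0 : 0 < k) (h : k < p) : (k : ZMod p) * u p k = 1 := by
  apply mul_inv_cancel₀
  rw [Ne, ZMod.natCast_eq_zero_iff]
  exact Nat.not_dvd_of_pos_of_lt h0 h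

/-- partial fractions -/
lemma u_pf {n j : ℕ} (hj : 0 < j) (hjn : j < n) (hn : n < p) :
    u p j * u p (n - j) = u p n * (u p j + u p (n - j)) := by
  have h1 := u_cancel p hj (hjn.trans hn)
  have h2 := u_cancel p (Nat.sub_pos_of_lt hjn) (by omega : n - j < p)
  have h3 := u_cancel p (by omega : 0 < n) hn
  rw [Nat.cast_sub hjn.le] at h2
  linear_combination (-u p j * u p (n-j)) * h3 + u p n * u p j * h2 + u p n * u p (n-j) * h1

lemma sum_rev0 (f : ℕ → ZMod p) (n : ℕ) (h0 : f 0 = 0) :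
    ∑ j ∈ range n, f (n - j) = S (n+1) f := by
  rw [S, sum_range_succ' f n, h0, add_zero, ← sum_range_reflect]
  refine sum_congr rfl (fun j hj => ?_)
  rw [mem_range] at hj
  congr 1; omega

/-- `∑_{j<n} u j * u (n-j) = 2 u n H(n)`. -/
lemma conv_uu {n : ℕ} (hn : n < p) :
    ∑ j ∈ range n, u p j * u p (n - j) = 2 * u p n * S n (u p) := by
  have h1 : ∀ j ∈ range n, u p j * u p (n - j) =
      u p n * (u p j + u p (n - j)) - (if j = 0 then u p n * u p n else 0) := by
    intro j hj
    rw [mem_range] at hj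
    rcases Nat.eq_zero_or_pos j with rfl | h
    · simp [u_zero]
    · rw [u_pf p h hj hn, if_neg h.ne']; ring
  rw [sum_congr rfl h1, sum_sub_distrib, ← mul_sum, sum_add_distrib, sum_rev0 p _ _ (u_zero p),
    S_succ, sum_ite_eq' ]
  rcases Nat.eq_zero_or_pos n with rfl | h
  · simp [u_zero, S]
  · rw [if_pos (mem_range.2 h)]
    change u p n * (S n (u p) + _) - _ = _
    ring

/-- `∑_{j<n} H(j) u(n-j) = 2 D n u u`. -/
lemma conv_Hu {n : ℕ} (hn : n ≤ p) :
    ∑ j ∈ range n, S j (u p) * u p (n - j) = 2 * D n (u p) (u p) := by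
  induction n with
  | zero => simp [D_zero]
  | succ n ih =>
    rw [sum_range_succ', D_succ, mul_add, ← ih (by omega), S_zero, zero_mul, add_zero]
    have : ∀ j ∈ range n, S (j+1) (u p) * u p (n + 1 - (j+1)) =
      S j (u p) * u p (n - j) + u p j * u p (n - j) := by
      intro j _; rw [S_succ, Nat.add_sub_add_right]; ring
    rw [sum_congr rfl this, sum_add_distrib, conv_uu p (by omega)]; ring

lemma sgn_split {n j : ℕ} (h : j ≤ n) : (-1 : ZMod p) ^ n = (-1) ^ j * (-1) ^ (n - j) := by
  rw [← pow_add]; congr 1; omega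

/-- H(v,v) = 2 H(u,v) -/
lemma D_vv (hp : p ≠ 2) : D p (v p) (v p) = 2 * D p (u p) (v p) := by
  rw [D_shift]
  simp only [D, mul_sum]
  refine sum_congr rfl (fun k hk => ?_)
  rw [mem_range] at hk
  have : ∀ j ∈ range k, v p j * v p (p - (k - j)) = (-1) ^ k * (u p j * u p (k - j)) := by
    intro j hj
    rw [mem_range] at hj
    rw [v_rev p hp (by omega), v_eq, v_eq, sgn_split p hj.le]; ring
  rw [sum_congr rfl this, ← mul_sum, conv_uu p hk, v_eq]; ring

/-- H(u,v,v) = 3 H(u,u,v) -/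
lemma T_uvv (hp : p ≠ 2) : T p (u p) (v p) (v p) = 3 * T p (u p) (u p) (v p) := by
  have h0 : T p (u p) (v p) (v p) = D p (fun j => S j (u p) * v p j) (v p) := rfl
  rw [h0, D_shift]
  simp only [T, mul_sum]
  refine sum_congr rfl (fun k hk => ?_)
  rw [mem_range] at hk
  have : ∀ j ∈ range k, S j (u p) * v p j * v p (p - (k - j)) =
      (-1) ^ k * u p k * (S j (u p) * u p j + S j (u p) * u p (k - j)) := by
    intro j hj
    rw [mem_range] at hj
    rw [v_rev p hp (by omega), v_eq, v_eq, sgn_split p hj.le]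
    rcases Nat.eq_zero_or_pos j with rfl | h
    · simp [S_zero]
    · linear_combination (-1) ^ j * (-1) ^ (k - j) * S j (u p) * u_pf p h hj hk
  rw [sum_congr rfl this, ← mul_sum, sum_add_distrib, conv_Hu p hk.le, v_eq]
  change _ * (D k (u p) (u p) + _) = _
  ring

/-- H(v², v)-type: H(\bar2,\bar1) = H(2,\bar1) + 2 H(1,\bar2) -/
lemma D_21 (hp : p ≠ 2) : D p (fun k => u p k * v p k) (v p) =
    D p (fun k => u p k * u p k) (v p) + 2 * D p (u p) (fun k => u p k * v p k) := by
  rw [D_shift]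
  simp only [D, mul_sum, ← sum_add_distrib]
  refine sum_congr rfl (fun k hk => ?_)
  rw [mem_range] at hk
  have : ∀ j ∈ range k, u p j * v p j * v p (p - (k - j)) =
      (-1) ^ k * u p k * (u p j * u p j) + (-1) ^ k * u p k * (u p j * u p (k - j)) := by
    intro j hj
    rw [mem_range] at hj
    rw [v_rev p hp (by omega), v_eq, v_eq, sgn_split p hj.le]
    rcases Nat.eq_zero_or_pos j with rfl | h
    · simp [u_zero]
    · linear_combination (-1) ^ j * (-1) ^ (k - j) * u p j * u_pf p h hj hk
  rw [sum_congr rfl this, sum_add_distrib, ← mul_sum, ← mul_sum, conv_uu p hk, v_eq]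
  change _ * S k _ + _ = _
  ring

lemma D_ext (f g : ℕ → ZMod p) (h : g p = 0) : D (p+1) f g = D p f g := by
  rw [D_succ, h]; ring
lemma T_ext (f g k : ℕ → ZMod p) (h : k p = 0) : T (p+1) f g k = T p f g k := by
  rw [T_succ, h]; ring

lemma T_neg (n : ℕ) (f g h : ℕ → ZMod p) : T n f (fun k => - g k) h = - T n f g h := by
  simp [T, D]

lemma two_ne (hp : p ≠ 2) : (2 : ZMod p) ≠ 0 := by
  have := ZMod.natCast_eq_zero_iff 2 p
  intro h
  have := this.1 (by exact_mod_cast h)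
  exact hp ((Nat.prime_dvd_prime_iff_eq Fact.out Nat.prime_two).1 this)

lemma T_vuv (hp : p ≠ 2) : T p (v p) (u p) (v p) = 0 := by
  have h := T_rev p (v p) (u p) (v p)
  rw [T_congr (n := p+1) (f' := v p) (g' := fun k => - u p k) (k' := v p)
    (fun k hk => v_rev p hp (by omega)) (fun k hk => u_rev p (by omega))
    (fun k hk => v_rev p hp (by omega)), T_neg, T_ext _ _ _ _ (v_p p)] at h
  have : 2 * T p (v p) (u p) (v p) = 0 := by linear_combination h
  simpa [two_ne p hp] using this

/-- H(2,\bar1) = H(\bar1,2) -/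
lemma D_2b1 (hp : p ≠ 2) : D p (fun k => u p k * u p k) (v p) = D p (v p) (fun k => u p k * u p k) := by
  rw [← D_ext _ _ _ (v_p p), ← D_ext _ _ (fun k => u p k * u p k) (by simp [u_p]), D_rev]
  refine D_congr (fun k hk => v_rev p hp (by omega)) (fun k hk => ?_)
  simp only [u_rev p (by omega : k ≤ p)]; ring

lemma D_1b2 (hp : p ≠ 2) : D p (u p) (fun k => u p k * v p k) = D p (fun k => u p k * v p k) (u p) := by
  rw [← D_ext _ _ _ (u_p p), ← D_ext _ _ (fun k => u p k * v p k) (by simp [u_p]), D_rev]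
  have : D (p+1) (fun k => u p k * v p k) (u p) =
    D (p+1) (fun k => - (u p k * v p k)) (fun k => - u p k) := by simp [D, S]
  rw [this]
  refine D_congr (fun k hk => ?_) (fun k hk => u_rev p (by omega))
  simp only [u_rev p (by omega : k ≤ p), v_rev p hp (by omega : k ≤ p)]; ring

/-- Main combinatorial identity. -/
lemma main_comb (hp : p ≠ 2) (hp3 : p ≠ 3) (s1 : S p (u p) = 0) (s2 : S p (fun k => u p k * u p k) = 0)
    (s3 : S p (fun k => u p k * (u p k * u p k)) = 0) (q b : ZMod p)
    (hq : S p (v p) = -2 * q) (hb : S p (fun k => u p k * (u p k * v p k)) * 2 = - b)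
    (h12 : D p (u p) (fun k => u p k * u p k) = b) :
    T p (u p) (u p) (u p) = 0 ∧ 24 * T p (u p) (u p) (v p) = - 8 * q ^ 3 - 7 * b := by
  have e2 : (2 : ZMod p) ≠ 0 := two_ne p hp
  have e3 : (3 : ZMod p) ≠ 0 := by
    have := ZMod.natCast_eq_zero_iff 3 p
    intro h
    have := this.1 (by exact_mod_cast h)
    exact hp3 ((Nat.prime_dvd_prime_iff_eq Fact.out Nat.prime_three).1 this)
  constructor
  · have h1 := stuffle3 p (u p) (u p) (u p)
    have h2 := stuffle2 p (u p) (fun k => u p k * u p k)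
    rw [s1, s3] at h2
    rw [s1] at h1
    have : 3 * T p (u p) (u p) (u p) = 0 := by linear_combination -h1 + h2
    simpa [e3] using this
  · have vv : (fun k => v p k * v p k) = (fun k => u p k * u p k) := by
      funext k; rw [v_eq]; linear_combination (u p k)^2 * sgn_sq p k
    have vu : (fun k => v p k * u p k) = (fun k => u p k * v p k) := by
      funext k; ring
    have h3 := stuffle3 p (v p) (u p) (v p)
    have h2 := stuffle2 p (v p) (v p)
    have d := D_vv p hp
    have t := T_uvv p hp
    have d21 := D_21 p hp
    have z := T_vuv p hp
    have a1 := D_2b1 p hp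
    have a2 := D_1b2 p hp
    have st1 := stuffle2 p (v p) (fun k => u p k * u p k)
    have st2 := stuffle2 p (u p) (fun k => u p k * v p k)
    have c : (fun k => v p k * (u p k * u p k)) = (fun k => u p k * (u p k * v p k)) := by
      funext k; ring
    rw [c, s2] at st1
    rw [s1] at st2
    rw [vv, vu, hq, h12, z] at h3
    rw [vv, s2, hq] at h2
    apply mul_left_cancel₀ e2
    generalize T p (u p) (u p) (v p) = A at *
    generalize T p (u p) (v p) (v p) = A' at *
    generalize D p (v p) (v p) = x1 at *
    generalize D p (u p) (v p) = x2 at *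
    generalize S p (fun k => u p k * (u p k * v p k)) = h at *
    generalize D p (fun k => u p k * v p k) (v p) = y1 at *
    generalize D p (fun k => u p k * u p k) (v p) = y2 at *
    generalize D p (u p) (fun k => u p k * v p k) = y3 at *
    generalize D p (v p) (fun k => u p k * u p k) = y4 at *
    generalize D p (fun k => u p k * v p k) (u p) = y5 at *
    have x2q : 4 * x2 = 4 * q ^ 2 := by linear_combination -h2 - 2 * d
    have y2' : 2 * y2 = - h := by linear_combination -st1 + a1
    have y3' : 2 * y3 = - h := by linear_combination -st2 + a2
    have y1' : 2 * y1 = -3 * h := by linear_combination 2 * d21 + y2' + 2 * y3'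
    linear_combination -8 * h3 - 16 * t - 4 * y1' -4 * q * x2q + 6 * hb
end modp
end TS

namespace TS
open Finset

section rep
variable (p : ℕ) [hpf : Fact p.Prime]

def Rep (x : ℚ) (z : ZMod p) : Prop :=
  ∃ y : ℤ_[p], (y : ℚ_[p]) = (x : ℚ_[p]) ∧ PadicInt.toZMod y = z

variable {p}
lemma Rep.add {x y : ℚ} {a b : ZMod p} (h : Rep p x a) (h' : Rep p y b) : Rep p (x + y) (a + b) := by
  obtain ⟨s, h1, h2⟩ := h
  obtain ⟨t, h3, h4⟩ := h'
  exact ⟨s + t, by push_cast; rw [h1, h3], by rw [map_add, h2, h4]⟩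
lemma Rep.mul {x y : ℚ} {a b : ZMod p} (h : Rep p x a) (h' : Rep p y b) : Rep p (x * y) (a * b) := by
  obtain ⟨s, h1, h2⟩ := h
  obtain ⟨t, h3, h4⟩ := h'
  exact ⟨s * t, by push_cast; rw [h1, h3], by rw [map_mul, h2, h4]⟩
lemma Rep.neg {x : ℚ} {a : ZMod p} (h : Rep p x a) : Rep p (-x) (-a) := by
  obtain ⟨s, h1, h2⟩ := h
  exact ⟨-s, by push_cast; rw [h1], by rw [map_neg, h2]⟩
lemma Rep.sub {x y : ℚ} {a b : ZMod p} (h : Rep p x a) (h' : Rep p y b) : Rep p (x - y) (a - b) := by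
  rw [sub_eq_add_neg, sub_eq_add_neg]; exact h.add h'.neg
lemma Rep.nat (n : ℕ) : Rep p (n : ℚ) (n : ZMod p) := ⟨n, by push_cast; rfl, by simp⟩
lemma Rep.pow {x : ℚ} {a : ZMod p} (h : Rep p x a) (n : ℕ) : Rep p (x ^ n) (a ^ n) := by
  obtain ⟨s, h1, h2⟩ := h
  exact ⟨s ^ n, by push_cast; rw [h1], by rw [map_pow, h2]⟩
lemma Rep.zero : Rep p 0 0 := by simpa using Rep.nat (p := p) 0
lemma Rep.sum {ι : Type*} (s : Finset ι) {f : ι → ℚ} {g : ι → ZMod p}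
    (h : ∀ i ∈ s, Rep p (f i) (g i)) : Rep p (∑ i ∈ s, f i) (∑ i ∈ s, g i) := by
  classical
  induction s using Finset.induction_on with
  | empty => simpa using Rep.zero
  | insert a s ha ih =>
    rw [sum_insert ha, sum_insert ha]
    exact (h a (mem_insert_self _ _)).add (ih (fun i hi => h i (mem_insert_of_mem hi)))
lemma Rep.unique {x : ℚ} {a b : ZMod p} (h : Rep p x a) (h' : Rep p x b) : a = b := by
  obtain ⟨s, h1, h2⟩ := h
  obtain ⟨t, h3, h4⟩ := h'
  have : s = t := Subtype.ext (h1.trans h3.symm)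
  rw [← h2, ← h4, this]
lemma Rep.inv {n : ℕ} (h : ¬ p ∣ n) : Rep p (n : ℚ)⁻¹ (n : ZMod p)⁻¹ := by
  have hu : IsUnit (n : ℤ_[p]) := by
    rw [PadicInt.isUnit_iff, PadicInt.norm_natCast_eq_one_iff]
    exact (Nat.Prime.coprime_iff_not_dvd hpf.out).2 h
  obtain ⟨w, hw⟩ := hu
  have hw1 : (n : ℤ_[p]) * (↑w⁻¹ : ℤ_[p]) = 1 := by rw [← hw]; simp
  refine ⟨(↑w⁻¹ : ℤ_[p]), ?_, ?_⟩
  · have := congrArg (fun t : ℤ_[p] => (t : ℚ_[p])) hw1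
    push_cast at this ⊢
    exact eq_inv_of_mul_eq_one_right this
  · have := congrArg (PadicInt.toZMod (p := p)) hw1
    simp only [map_mul, map_natCast, map_one] at this
    exact eq_inv_of_mul_eq_one_right this
lemma Rep.final {x y : ℚ} {a : ZMod p} (h : Rep p x a) (h' : Rep p y a) :
    ‖((x - y : ℚ) : ℚ_[p])‖ ≤ (p : ℝ) ^ (-(1 : ℤ)) := by
  obtain ⟨s, h1, h2⟩ := h.sub h'
  rw [sub_self] at h2
  rw [← h1]
  have : s ∈ RingHom.ker (PadicInt.toZMod (p := p)) := h2
  rw [PadicInt.ker_toZMod, PadicInt.maximalIdeal_eq_span_p] at this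
  have h3 := (PadicInt.norm_le_pow_iff_mem_span_pow s 1).2 (by simpa using this)
  simpa using h3

lemma not_dvd {n : ℕ} (h0 : 0 < n) (h : n < p) : ¬ p ∣ n := Nat.not_dvd_of_pos_of_lt h0 h

lemma rep_bernoulli (n : ℕ) (hn : n + 1 < p) : ∃ z, Rep p (bernoulli n) z := by
  induction n using Nat.strong_induction_on with
  | _ n ih =>
    have h := sum_bernoulli (n + 1)
    rw [sum_range_succ] at h
    have h1 : ∃ z, Rep p (∑ k ∈ range n, ((n+1).choose k : ℚ) * bernoulli k) z := by
      have : ∀ k : ℕ, ∃ z, k < n → Rep p (bernoulli k) z := by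
        intro k
        by_cases hk : k < n
        · obtain ⟨z, hz⟩ := ih k hk (by omega)
          exact ⟨z, fun _ => hz⟩
        · exact ⟨0, fun h => absurd h hk⟩
      choose f hf using this
      exact ⟨_, Rep.sum _ (fun k hk => (Rep.nat ((n+1).choose k)).mul (hf k (mem_range.1 hk)))⟩
    have h2 : ∃ z, Rep p (if n + 1 = 1 then (1:ℚ) else 0) z := by
      split_ifs
      · exact ⟨_, by simpa using Rep.nat (p := p) 1⟩
      · exact ⟨_, Rep.zero⟩
    obtain ⟨z1, h1⟩ := h1
    obtain ⟨z2, h2⟩ := h2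
    have h3 := (h2.sub h1).mul (Rep.inv (not_dvd (p := p) (Nat.succ_pos n) hn))
    refine ⟨(z2 - z1) * ((n + 1 : ℕ) : ZMod p)⁻¹, ?_⟩
    · convert h3 using 1
      rw [← h]
      have : ((n+1 : ℕ) : ℚ) ≠ 0 := by positivity
      have e : ((n+1).choose n : ℚ) = ((n+1 : ℕ) : ℚ) := by rw [Nat.choose_succ_self_right]
      rw [e]
      field_simp
      ring

variable (p)
lemma sum_range_zmod (f : ZMod p → ZMod p) : ∑ k ∈ range p, f (k : ZMod p) = ∑ x : ZMod p, f x := by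
  refine sum_nbij' (fun k => (k : ZMod p)) (fun x => x.val) ?_ ?_ ?_ ?_ ?_
  · simp
  · intro x _; simpa using ZMod.val_lt x
  · intro k hk; exact ZMod.val_cast_of_lt (mem_range.1 hk)
  · intro x _; simp
  · simp

lemma sum_range_pred (f : ℕ → ZMod p) (n : ℕ) (hn : 0 < n) :
    ∑ k ∈ range n, f k = ∑ k ∈ range (n - 1), f (k + 1) + f 0 := by
  obtain ⟨m, rfl⟩ := Nat.exists_eq_succ_of_ne_zero hn.ne'
  exact sum_range_succ' f m

lemma psum {i : ℕ} (h : i < p - 1) : ∑ k ∈ range p, (k : ZMod p) ^ i = 0 := by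
  rw [sum_range_zmod p (fun x => x ^ i)]
  exact FiniteField.sum_pow_lt_card_sub_one _ i (by simpa using h)

lemma inv_pow_eq {x : ZMod p} {a b : ℕ} (ha : 0 < a) (hb : 0 < b) (h : a + b = p - 1) :
    x ^ a = x⁻¹ ^ b := by
  rcases eq_or_ne x 0 with rfl | hx
  · simp [ha.ne', hb.ne']
  · have := ZMod.pow_card_sub_one_eq_one hx
    rw [inv_pow]
    apply eq_inv_of_mul_eq_one_left
    rw [← pow_add, h, this]

lemma S1 (h5 : 5 ≤ p) : S p (u p) = 0 := by
  rw [← psum p (i := p - 2) (by omega)]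
  exact sum_congr rfl (fun k _ => by
    rw [inv_pow_eq p (b := 1) (by omega) (by omega) (by omega)]; simp [u])
lemma S2 (h5 : 5 ≤ p) : S p (fun k => u p k * u p k) = 0 := by
  rw [← psum p (i := p - 3) (by omega)]
  exact sum_congr rfl (fun k _ => by
    rw [inv_pow_eq p (b := 2) (by omega) (by omega) (by omega)]; simp only [u]; ring)
lemma S3 (h5 : 5 ≤ p) : S p (fun k => u p k * (u p k * u p k)) = 0 := by
  rw [← psum p (i := p - 4) (by omega)]
  exact sum_congr rfl (fun k _ => by
    rw [inv_pow_eq p (b := 3) (by omega) (by omega) (by omega)]; simp only [u]; ring)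

lemma exists_b : ∃ b : ℕ → ZMod p, ∀ r, r + 1 < p → Rep p (bernoulli r) (b r) := by
  have : ∀ r : ℕ, ∃ z, r + 1 < p → Rep p (bernoulli r) z := by
    intro r
    by_cases h : r + 1 < p
    · obtain ⟨z, hz⟩ := rep_bernoulli r h
      exact ⟨z, fun _ => hz⟩
    · exact ⟨0, fun h' => absurd h' h⟩
  choose b hb using this
  exact ⟨b, hb⟩

/-- Faulhaber mod p -/
lemma faulhaber (b : ℕ → ZMod p) (hb : ∀ r, r + 1 < p → Rep p (bernoulli r) (b r)) (e : ℕ)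
    (he : e + 1 < p) (n : ℕ) :
    ∑ k ∈ range n, (k : ZMod p) ^ e =
      ∑ r ∈ range (e+1), b r * ((e+1).choose r : ℕ) * (n : ZMod p) ^ (e + 1 - r) * ((e+1 : ℕ) : ZMod p)⁻¹ := by
  have h1 : Rep p (∑ k ∈ range n, (k : ℚ) ^ e) (∑ k ∈ range n, (k : ZMod p) ^ e) :=
    Rep.sum _ (fun k _ => (Rep.nat k).pow e)
  rw [sum_range_pow] at h1
  refine h1.unique ?_
  refine Rep.sum _ (fun r hr => ?_)
  rw [mem_range] at hr
  have := (((hb r (by omega)).mul (Rep.nat ((e+1).choose r))).mul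
    ((Rep.nat n).pow (e+1-r))).mul (Rep.inv (not_dvd (p := p) (Nat.succ_pos e) he))
  rw [div_eq_mul_inv]
  convert this using 2
  push_cast; rfl

lemma H12 (h5 : 5 ≤ p) (b : ℕ → ZMod p) (hb : ∀ r, r + 1 < p → Rep p (bernoulli r) (b r)) :
    D p (u p) (fun k => u p k * u p k) = b (p - 3) := by
  have hF : ∀ j, S j (u p) = ∑ r ∈ range (p - 1),
      b r * ((p-1).choose r : ℕ) * (j : ZMod p) ^ (p - 1 - r) * (-1) := by
    intro j
    have := faulhaber p b hb (p-2) (by omega) j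
    have e : p - 2 + 1 = p - 1 := by omega
    rw [e] at this
    have e2 : ((p - 1 : ℕ) : ZMod p)⁻¹ = -1 := by
      rw [Nat.cast_sub (by omega)]; simp
    rw [e2] at this
    rw [← this]
    exact sum_congr rfl (fun k _ => by
      rw [inv_pow_eq p (b := 1) (by omega) (by omega) (by omega)]; simp [u])
  have h1 : D p (u p) (fun k => u p k * u p k) = ∑ r ∈ range (p-1),
      b r * ((p-1).choose r : ℕ) * (-1) * ∑ j ∈ range p, (j : ZMod p) ^ (p - 1 - r) * (u p j * u p j) := by
    simp only [D, hF, sum_mul, mul_sum]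
    rw [sum_comm]
    exact sum_congr rfl (fun r _ => sum_congr rfl (fun j _ => by ring))
  rw [h1, sum_eq_single (p - 3)]
  · have e1 : ∑ j ∈ range p, (j : ZMod p) ^ (p - 1 - (p - 3)) * (u p j * u p j) = -1 := by
      have e : p = (p - 1) + 1 := by omega
      have : ∀ j ∈ range (p - 1), ((j+1 : ℕ) : ZMod p) ^ (p - 1 - (p - 3)) * (u p (j+1) * u p (j+1)) = 1 := by
        intro j hj
        rw [mem_range] at hj
        have := u_cancel p (Nat.succ_pos j) (by omega : j + 1 < p)
        rw [show p - 1 - (p - 3) = 2 by omega]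
        linear_combination ((j+1 : ℕ) * u p (j+1) + 1) * this
      rw [sum_range_pred p _ p (by omega), sum_congr rfl this, u_zero]
      simp [Nat.cast_sub (by omega : 1 ≤ p)]
    have e2 : (((p-1).choose (p-3) : ℕ) : ZMod p) = 1 := by
      have h2 : (p-1).choose (p-3) * 2 = (p - 1) * (p - 2) := by
        rw [show p - 3 = p - 1 - 2 by omega, Nat.choose_symm (by omega), Nat.choose_two_right,
          show p - 1 - 1 = p - 2 by omega]
        apply Nat.div_mul_cancel
        have := Nat.even_mul_succ_self (p-2)
        rw [show p - 2 + 1 = p - 1 by omega, mul_comm] at this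
        exact this.two_dvd
      have h3 := congrArg (Nat.cast : ℕ → ZMod p) h2
      push_cast [Nat.cast_sub (by omega : 1 ≤ p), Nat.cast_sub (by omega : 2 ≤ p)] at h3
      apply mul_right_cancel₀ (two_ne p (by omega))
      rw [h3]; simp
    rw [e1, e2]; ring
  · intro r hr hne
    rw [mem_range] at hr
    have : ∑ j ∈ range p, (j : ZMod p) ^ (p - 1 - r) * (u p j * u p j) = 0 := by
      rcases Nat.lt_or_ge r (p - 3) with h | h
      · rw [← psum p (i := p - 3 - r) (by omega)]
        refine sum_congr rfl (fun j hj => ?_)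
        rw [mem_range] at hj
        rcases Nat.eq_zero_or_pos j with rfl | h0
        · rw [u_zero, Nat.cast_zero, zero_pow (by omega : p - 3 - r ≠ 0)]; simp
        · have := u_cancel p h0 hj
          rw [show p - 1 - r = (p - 3 - r) + 2 by omega, pow_add]
          linear_combination (j : ZMod p) ^ (p-3-r) * (j * u p j + 1) * this
      · rw [← S1 p h5]
        refine sum_congr rfl (fun j hj => ?_)
        rw [mem_range] at hj
        rcases Nat.eq_zero_or_pos j with rfl | h0
        · rw [u_zero]; simp
        · have := u_cancel p h0 hj
          rw [show p - 1 - r = 1 by omega]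
          linear_combination u p j * this
    rw [this, mul_zero]
  · intro h; exact absurd (mem_range.2 (by omega)) h

lemma bern_half (n : ℕ) : ∑ i ∈ range n, bernoulli i * (n.choose i : ℚ) * (2⁻¹ : ℚ) ^ (n - i)
    = (2 / 2 ^ n - 2) * bernoulli n := by
  have h := bernoulliFun_eval_half n
  have h1 : bernoulliFun n 2⁻¹ = (((Polynomial.bernoulli n).eval (2⁻¹ : ℚ) : ℚ) : ℝ) := by
    rw [bernoulliFun]
    have := Polynomial.eval_map_algebraMap (B := ℝ) (Polynomial.bernoulli n) ((2⁻¹ : ℚ) : ℝ)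
    rw [show ((2:ℝ)⁻¹) = algebraMap ℚ ℝ (2⁻¹ : ℚ) by simp, Polynomial.eval_map_algebraMap,
      Polynomial.aeval_algebraMap_apply]
    simp
  rw [h1] at h
  have h2 : (Polynomial.bernoulli n).eval (2⁻¹ : ℚ) = (2 / 2 ^ n - 1) * bernoulli n := by
    apply Rat.cast_injective (α := ℝ)
    push_cast
    exact h
  rw [Polynomial.bernoulli_def, Polynomial.eval_finsetSum, sum_range_succ'] at h2
  rw [← sum_range_reflect]
  simp only [Polynomial.eval_monomial] at h2
  simp at h2
  have : ∑ j ∈ range n, bernoulli (n - 1 - j) * (n.choose (n - 1 - j) : ℚ) * (2⁻¹ : ℚ) ^ (n - (n - 1 - j)) =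
      ∑ k ∈ range n, bernoulli (n - (k+1)) * (n.choose (k+1) : ℚ) * ((2:ℚ) ^ (k+1))⁻¹ := by
    refine sum_congr rfl (fun j hj => ?_)
    rw [mem_range] at hj
    rw [show n - 1 - j = n - (j+1) by omega, Nat.choose_symm (by omega : j + 1 ≤ n),
      Nat.sub_sub_self (by omega), inv_pow]
  rw [this]
  linear_combination h2

lemma half_sum (h5 : 5 ≤ p) (b : ℕ → ZMod p) (hb : ∀ r, r + 1 < p → Rep p (bernoulli r) (b r))
    (m : ℕ) (hm : 2 * m = p + 1) :
    S m (fun k => u p k * (u p k * u p k)) = -2 * b (p - 3) := by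
  have h1 : S m (fun k => u p k * (u p k * u p k)) = ∑ k ∈ range m, (k : ZMod p) ^ (p - 4) :=
    sum_congr rfl (fun k _ => by
      rw [inv_pow_eq p (b := 3) (by omega) (by omega) (by omega)]; simp only [u]; ring)
  have e2 := two_ne p (by omega)
  have hm' : (m : ZMod p) = ((2 : ℕ) : ZMod p)⁻¹ := by
    have := congrArg (Nat.cast : ℕ → ZMod p) hm
    push_cast at this ⊢
    rw [ZMod.natCast_self, zero_add] at this
    exact eq_inv_of_mul_eq_one_right this
  rw [h1, faulhaber p b hb (p-4) (by omega) m, ← sum_mul, hm', show p - 4 + 1 = p - 3 by omega]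
  have r1 : Rep p (∑ i ∈ range (p-3), bernoulli i * ((p-3).choose i : ℚ) * (2⁻¹ : ℚ) ^ (p-3 - i))
     (∑ r ∈ range (p-3), b r * ((p-3).choose r : ℕ) * ((2 : ℕ) : ZMod p)⁻¹ ^ (p - 3 - r)) := by
    refine Rep.sum _ (fun r hr => ?_)
    rw [mem_range] at hr
    have := Rep.inv (not_dvd (p := p) (n := 2) (by omega) (by omega))
    have := ((hb r (by omega)).mul (Rep.nat ((p-3).choose r))).mul (this.pow (p-3-r))
    exact_mod_cast this
  rw [bern_half] at r1
  have i2 := Rep.inv (not_dvd (p := p) (n := 2) (by omega) (by omega))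
  have r2 := (((Rep.nat 2).mul (i2.pow (p-3))).sub (Rep.nat 2)).mul (hb (p-3) (by omega))
  have r2' : Rep p ((2 / 2 ^ (p-3) - 2) * bernoulli (p-3))
     (((2 : ℕ) * ((2 : ℕ) : ZMod p)⁻¹ ^ (p-3) - (2 : ℕ)) * b (p-3)) := by
    convert r2 using 2
    push_cast
    rw [inv_pow, div_eq_mul_inv]
  rw [r1.unique r2', inv_pow_eq p (b := 2) (by omega) (by omega) (by omega)]
  have e3 : ((p - 3 : ℕ) : ZMod p)⁻¹ = (-3)⁻¹ := by
    rw [Nat.cast_sub (by omega)]; simp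
  have e3' : (3 : ZMod p) ≠ 0 := by
    intro h
    have := (ZMod.natCast_eq_zero_iff 3 p).1 (by exact_mod_cast h)
    have := Nat.le_of_dvd (by norm_num) this
    omega
  rw [e3]
  push_cast
  rw [inv_inv]
  field_simp
  ring

lemma even_sum (f : ℕ → ZMod p) (m : ℕ) :
    ∑ k ∈ range (2 * m), (1 + (-1) ^ k) * f k = 2 * ∑ k ∈ range m, f (2 * k) := by
  induction m with
  | zero => simp
  | succ m ih =>
    rw [show 2 * (m+1) = 2 * m + 1 + 1 by ring, sum_range_succ, sum_range_succ, ih, sum_range_succ,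
      pow_succ, pow_mul]
    simp; ring

lemma hbar (h5 : 5 ≤ p) (b : ℕ → ZMod p) (hb : ∀ r, r + 1 < p → Rep p (bernoulli r) (b r)) :
    S p (fun k => u p k * (u p k * v p k)) * 2 = - b (p-3) := by
  obtain ⟨m, hm⟩ : ∃ m, 2 * m = p + 1 := by
    obtain ⟨k, hk⟩ := hpf.out.odd_of_ne_two (by omega)
    exact ⟨k + 1, by omega⟩
  have h := even_sum p (fun k => u p k * (u p k * u p k)) m
  rw [hm, sum_range_succ, u_p] at h
  have h1 : ∑ k ∈ range p, (1 + (-1) ^ k) * (u p k * (u p k * u p k)) =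
      S p (fun k => u p k * (u p k * u p k)) + S p (fun k => u p k * (u p k * v p k)) := by
    simp only [S, ← sum_add_distrib]
    exact sum_congr rfl (fun k _ => by rw [v_eq]; ring)
  have h2 : ∑ k ∈ range m, (u p (2*k) * (u p (2*k) * u p (2*k))) =
      (2⁻¹ : ZMod p)^3 * S m (fun k => u p k * (u p k * u p k)) := by
    simp only [S, mul_sum]
    exact sum_congr rfl (fun k _ => by simp only [u]; push_cast; rw [mul_inv]; ring)
  rw [h1, h2, S3 p h5, half_sum p h5 b hb m hm] at h
  have e2 := two_ne p (by omega)
  have e : (2 : ZMod p) * 2⁻¹ = 1 := mul_inv_cancel₀ e2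
  have h3 : S p (fun k => u p k * (u p k * v p k)) = - 4 * 2⁻¹^3 * b (p-3) := by linear_combination h
  rw [h3]
  field_simp
  norm_num

lemma choose_sgn (k : ℕ) (hk : k < p) : (((p-1).choose k : ℕ) : ZMod p) = (-1) ^ k := by
  induction k with
  | zero => simp
  | succ k ih =>
    have h := Nat.choose_succ_succ (p-1) k
    have hp := hpf.out.pos
    rw [Nat.succ_eq_add_one, show p - 1 + 1 = p by omega] at h
    have h2 : ((p.choose (k+1) : ℕ) : ZMod p) = 0 := by
      rw [ZMod.natCast_eq_zero_iff]
      exact hpf.out.dvd_choose_self (by omega) hk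
    rw [h] at h2
    push_cast at h2
    rw [ih (by omega)] at h2
    rw [pow_succ]; linear_combination h2

lemma rep_q (h5 : 5 ≤ p) : ∃ q, Rep p ((2 ^ (p - 1) - 1 : ℚ) / p) q ∧ S p (v p) = -2 * q := by
  have hp0 : (p : ℚ) ≠ 0 := by positivity
  have e : p = (p - 1) + 1 := by omega
  have h1 : (2 ^ (p - 1) - 1 : ℚ) / p =
      ((2 : ℕ) : ℚ)⁻¹ * ∑ k ∈ range (p-1), ((p-1).choose k : ℚ) * ((k+1 : ℕ) : ℚ)⁻¹ := by
    have h2 : ∀ k ∈ range (p-1), ((p-1).choose k : ℚ) * ((k+1 : ℕ) : ℚ)⁻¹ = (p.choose (k+1) : ℚ) / p := by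
      intro k _
      have := Nat.add_one_mul_choose_eq (p-1) k
      rw [← e] at this
      have : (p : ℚ) * ((p-1).choose k : ℚ) = (p.choose (k+1) : ℚ) * ((k+1 : ℕ) : ℚ) := by exact_mod_cast this
      have h0 : ((k+1 : ℕ) : ℚ) ≠ 0 := by positivity
      field_simp
      linear_combination this
    rw [sum_congr rfl h2, ← sum_div]
    have h3 := Nat.sum_range_choose p
    rw [sum_range_succ] at h3
    conv_lhs at h3 => rw [e]
    rw [sum_range_succ', ← e] at h3
    simp only [Nat.choose_self, Nat.choose_zero_right] at h3
    have h4 : (∑ k ∈ range (p-1), (p.choose (k+1) : ℚ)) + 1 + 1 = 2 ^ p := by exact_mod_cast h3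
    have h5 : (2:ℚ) ^ p = 2 ^ (p-1) * 2 := by rw [← pow_succ, ← e]
    rw [h5] at h4
    field_simp
    push_cast
    linear_combination -h4
  have h2 : Rep p ((2 ^ (p - 1) - 1 : ℚ) / p)
      (((2 : ℕ) : ZMod p)⁻¹ * ∑ k ∈ range (p-1), (((p-1).choose k : ℕ) : ZMod p) * ((k+1 : ℕ) : ZMod p)⁻¹) := by
    rw [h1]
    refine (Rep.inv (not_dvd (by omega) (by omega))).mul (Rep.sum _ (fun k hk => ?_))
    rw [mem_range] at hk
    exact (Rep.nat _).mul (Rep.inv (not_dvd (by omega) (by omega)))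
  refine ⟨_, h2, ?_⟩
  have e2 := two_ne p (by omega)
  push_cast
  rw [← mul_assoc, neg_mul, mul_inv_cancel₀ e2]
  have : S p (v p) = ∑ k ∈ range (p-1), v p (k+1) := by
    rw [S]
    rw [sum_range_pred p _ p (by omega), v_zero, add_zero]
  rw [this, neg_one_mul, ← sum_neg_distrib]
  refine sum_congr rfl (fun k hk => ?_)
  rw [mem_range] at hk
  rw [choose_sgn p k (by omega), v, pow_succ]; push_cast; ring

lemma sum_Icc (f : ℕ → ZMod p) (n : ℕ) (h : f 0 = 0) :
    ∑ k ∈ Icc 1 (n - 1), f k = ∑ k ∈ range n, f k := by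
  refine sum_subset (fun k hk => ?_) (fun k hk hk' => ?_)
  · simp at hk ⊢; omega
  · have : k = 0 := by
      simp at hk hk'; omega
    rw [this, h]

lemma rep_triple (h5 : 5 ≤ p) : Rep p (∑ k ∈ (Finset.Icc 1 (p - 1)).filter (fun k => Even k),
          ∑ j ∈ Finset.Icc 1 (k - 1), ∑ i ∈ Finset.Icc 1 (j - 1), (1 : ℚ) / (i * j * k))
    (2⁻¹ * (T p (u p) (u p) (u p) + T p (u p) (u p) (v p))) := by
  have h1 : Rep p (∑ k ∈ (Finset.Icc 1 (p - 1)).filter (fun k => Even k),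
          ∑ j ∈ Finset.Icc 1 (k - 1), ∑ i ∈ Finset.Icc 1 (j - 1), (1 : ℚ) / (i * j * k))
      (∑ k ∈ (Finset.Icc 1 (p - 1)).filter (fun k => Even k),
          ∑ j ∈ Finset.Icc 1 (k - 1), ∑ i ∈ Finset.Icc 1 (j - 1), u p i * u p j * u p k) := by
    refine Rep.sum _ (fun k hk => Rep.sum _ (fun j hj => Rep.sum _ (fun i hi => ?_)))
    simp only [mem_filter, mem_Icc] at hk hj hi
    rw [one_div, mul_inv, mul_inv]
    exact ((Rep.inv (not_dvd (by omega) (by omega))).mul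
      (Rep.inv (not_dvd (by omega) (by omega)))).mul (Rep.inv (not_dvd (by omega) (by omega)))
  convert h1 using 1
  have h2 : ∀ k, ∑ j ∈ Finset.Icc 1 (k - 1), ∑ i ∈ Finset.Icc 1 (j - 1), u p i * u p j * u p k =
      D k (u p) (u p) * u p k := by
    intro k
    rw [D, sum_mul, ← sum_Icc p _ k (by simp [S_zero])]
    refine sum_congr rfl (fun j _ => ?_)
    rw [S, sum_mul, sum_mul, ← sum_Icc p _ j (by simp [u_zero])]
  simp only [h2]
  rw [sum_filter, sum_Icc p _ p (by simp [u_zero])]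
  simp only [T, ← sum_add_distrib, mul_sum]
  have e2 := two_ne p (by omega)
  refine sum_congr rfl (fun k _ => ?_)
  rw [v_eq]
  split_ifs with h
  · rw [h.neg_one_pow]; field_simp; ring
  · rw [(Nat.not_even_iff_odd.1 h).neg_one_pow]; ring
end rep
end TS

theorem triple_sum_ijk (p : ℕ) [Fact p.Prime] (h5 : 5 ≤ p) :
    ‖(((∑ k ∈ (Finset.Icc 1 (p - 1)).filter (fun k => Even k),
          ∑ j ∈ Finset.Icc 1 (k - 1), ∑ i ∈ Finset.Icc 1 (j - 1), (1 : ℚ) / (i * j * k))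
        - (-(1 / 6) * ((2 ^ (p - 1) - 1 : ℚ) / p) ^ 3 - (7 / 48) * bernoulli (p - 3)) : ℚ) : ℚ_[p])‖
      ≤ (p : ℝ) ^ (-(1 : ℤ)) := by
  obtain ⟨b, hb⟩ := TS.exists_b p
  obtain ⟨q, hq, hqv⟩ := TS.rep_q p h5
  obtain ⟨t0, t1⟩ := TS.main_comb p (by omega) (by omega) (TS.S1 p h5) (TS.S2 p h5) (TS.S3 p h5) q
    (b (p-3)) hqv (TS.hbar p h5 b hb) (TS.H12 p h5 b hb)
  refine (TS.rep_triple p h5).final ?_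
  have e2 := TS.two_ne p (by omega)
  have e3 : (3 : ZMod p) ≠ 0 := by
    intro h
    have := (ZMod.natCast_eq_zero_iff 3 p).1 (by exact_mod_cast h)
    have := Nat.le_of_dvd (by norm_num) this
    omega
  have hpp : p.Prime := Fact.out
  have n2 : ¬ p ∣ 2 := TS.not_dvd (by omega) (by omega)
  have n3 : ¬ p ∣ 3 := TS.not_dvd (by omega) (by omega)
  have i6 : TS.Rep p ((6 : ℕ) : ℚ)⁻¹ ((6 : ℕ) : ZMod p)⁻¹ := TS.Rep.inv (by
    rw [show 6 = 2 * 3 by norm_num, hpp.dvd_mul]; tauto)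
  have i48 : TS.Rep p ((48 : ℕ) : ℚ)⁻¹ ((48 : ℕ) : ZMod p)⁻¹ := TS.Rep.inv (by
    rw [show 48 = 2 ^ 4 * 3 by norm_num, hpp.dvd_mul]
    rintro (h | h)
    · exact n2 (hpp.dvd_of_dvd_pow h)
    · exact n3 h)
  have h := (i6.neg.mul (hq.pow 3)).sub (((TS.Rep.nat 7).mul i48).mul (hb (p-3) (by omega)))
  have h6 : ((6 : ℕ) : ZMod p) = 2 * 3 := by norm_num
  have h48 : ((48 : ℕ) : ZMod p) = 2 ^ 4 * 3 := by norm_num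
  convert h using 1
  · norm_num
  · rw [t0, h6, h48]
    push_cast
    field_simp
    linear_combination t1
end

section
/- For every prime p ≥ 5, Σ_{1 ≤ j < k ≤ p-1, k even} 1/(jk) - p Σ_{1 ≤ i < j < k ≤ p-1, k even} 1/(ijk) ≡ (1/2) q_2(p)^2 - (1/3) p q_2(p)^3 - (7/24) p B_{p-3} (mod p^2), as a congruence of p-integral rationals. -/
open Finset

namespace DMT

theorem prod_reflect {M : Type*} [CommMonoid M] (n : ℕ) (f : ℕ → M) :
    ∏ k ∈ Icc 1 (2 * n), f k = ∏ i ∈ Icc 1 n, (f i * f (2 * n + 1 - i)) := by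
  rw [Finset.prod_mul_distrib]
  have h : ∏ i ∈ Icc 1 n, f (2 * n + 1 - i) = ∏ k ∈ Icc (n + 1) (2 * n), f k := by
    refine Finset.prod_nbij' (fun i => 2 * n + 1 - i) (fun i => 2 * n + 1 - i) ?_ ?_ ?_ ?_ ?_
    · intro a ha; simp only [mem_Icc] at *; omega
    · intro a ha; simp only [mem_Icc] at *; omega
    · intro a ha; simp only [mem_Icc] at *; omega
    · intro a ha; simp only [mem_Icc] at *; omega
    · intro a ha; rfl
  rw [h, ← Finset.prod_union]
  · congr 1
    ext a; simp only [mem_union, mem_Icc]; omega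
  · rw [Finset.disjoint_left]; intro a; simp only [mem_Icc]; omega

theorem prod_evens {M : Type*} [CommMonoid M] (n : ℕ) (f : ℕ → M) :
    ∏ k ∈ (Icc 1 (2 * n)).filter (fun k => Even k), f k = ∏ i ∈ Icc 1 n, f (2 * i) := by
  symm
  refine Finset.prod_nbij' (fun i => 2 * i) (fun i => i / 2) ?_ ?_ ?_ ?_ ?_
  · intro a ha; simp only [mem_Icc, mem_filter, Nat.even_iff] at *; omega
  · intro a ha; simp only [mem_Icc, mem_filter, Nat.even_iff] at *; omega
  · intro a ha; simp only [mem_Icc] at *; omega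
  · intro a ha; simp only [mem_Icc, mem_filter, Nat.even_iff] at *; omega
  · intro a ha; rfl

theorem prod_parity {M : Type*} [CommMonoid M] (n : ℕ) (f : ℕ → M) :
    ∏ k ∈ Icc 1 (2 * n), f k = ∏ i ∈ Icc 1 n, (f (2 * i) * f (2 * n + 1 - 2 * i)) := by
  rw [Finset.prod_mul_distrib, ← prod_evens]
  rw [← Finset.prod_filter_mul_prod_filter_not (Icc 1 (2 * n)) (fun k => Even k)]
  congr 1
  symm
  refine Finset.prod_nbij' (fun i => 2 * n + 1 - 2 * i) (fun i => (2 * n + 1 - i) / 2) ?_ ?_ ?_ ?_ ?_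
  · intro a ha; simp only [mem_Icc, mem_filter, Nat.even_iff] at *; omega
  · intro a ha; simp only [mem_Icc, mem_filter, Nat.even_iff] at *; omega
  · intro a ha; simp only [mem_Icc] at *; omega
  · intro a ha; simp only [mem_Icc, mem_filter, Nat.even_iff] at *; omega
  · intro a ha; rfl

theorem sum_reflect {M : Type*} [AddCommMonoid M] (n : ℕ) (f : ℕ → M) :
    ∑ k ∈ Icc 1 (2 * n), f k = ∑ i ∈ Icc 1 n, (f i + f (2 * n + 1 - i)) :=
  prod_reflect (M := Multiplicative M) n f

theorem sum_evens {M : Type*} [AddCommMonoid M] (n : ℕ) (f : ℕ → M) :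
    ∑ k ∈ (Icc 1 (2 * n)).filter (fun k => Even k), f k = ∑ i ∈ Icc 1 n, f (2 * i) :=
  prod_evens (M := Multiplicative M) n f

theorem sum_parity {M : Type*} [AddCommMonoid M] (n : ℕ) (f : ℕ → M) :
    ∑ k ∈ Icc 1 (2 * n), f k = ∑ i ∈ Icc 1 n, (f (2 * i) + f (2 * n + 1 - 2 * i)) :=
  prod_parity (M := Multiplicative M) n f

theorem choose_even_sum (n : ℕ) :
    ∑ i ∈ Icc 1 n, (2 * n + 1).choose (2 * i) + 1 = 2 ^ (2 * n) := by
  rw [← Nat.sum_range_choose, Finset.sum_range_succ']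
  rw [Nat.choose_zero_right]
  congr 1
  have h : ∑ k ∈ range (2 * n), (2 * n).choose (k + 1) = ∑ k ∈ Icc 1 (2 * n), (2 * n).choose k := by
    rw [Finset.range_eq_Ico, Finset.sum_Ico_add' (fun k => (2 * n).choose k) 0 (2 * n) 1]
    rfl
  rw [h, sum_parity]
  refine Finset.sum_congr rfl fun i hi => ?_
  simp only [mem_Icc] at hi
  obtain ⟨j, rfl⟩ : ∃ j, i = j + 1 := ⟨i - 1, by omega⟩
  rw [show 2 * (j + 1) = (2 * j + 1) + 1 by ring, Nat.choose_succ_succ, add_comm]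
  congr 1
  rw [← Nat.choose_symm (by omega)]
  congr 1
  omega

theorem log_add {R : Type*} [CommRing R] (x y t : R) : ∃ d : R,
    6 * (t * (x + y + t * x * y)) - 3 * (t * (x + y + t * x * y)) ^ 2 + 2 * (t * (x + y + t * x * y)) ^ 3 =
    (6 * (t * x) - 3 * (t * x) ^ 2 + 2 * (t * x) ^ 3) + (6 * (t * y) - 3 * (t * y) ^ 2 + 2 * (t * y) ^ 3)
      + t ^ 4 * d :=
  ⟨-3 * x ^ 2 * y ^ 2 + 6 * (x + y) ^ 2 * x * y + 6 * t * (x + y) * x ^ 2 * y ^ 2 + 2 * t ^ 2 * x ^ 3 * y ^ 3, by ring⟩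

section
variable {p : ℕ} [hp : Fact p.Prime]

/-- reciprocal of k in the p-adic integers -/
noncomputable def r (p : ℕ) [Fact p.Prime] (k : ℕ) : ℤ_[p] := (k : ℤ_[p]).inv

theorem mul_r {k : ℕ} (h1 : 1 ≤ k) (h2 : k < p) : (k : ℤ_[p]) * r p k = 1 := by
  apply PadicInt.mul_inv
  rw [PadicInt.norm_natCast_eq_one_iff]
  exact (Nat.coprime_of_lt_prime (by omega) h2 hp.out)

theorem coe_r {k : ℕ} (h1 : 1 ≤ k) (h2 : k < p) : ((r p k : ℤ_[p]) : ℚ_[p]) = 1 / (k : ℚ_[p]) := by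
  have h := congrArg (fun x : ℤ_[p] => (x : ℚ_[p])) (mul_r h1 h2)
  simp only [PadicInt.coe_mul, PadicInt.coe_natCast, PadicInt.coe_one] at h
  have : (k : ℚ_[p]) ≠ 0 := by intro h0; rw [h0] at h; simp at h
  field_simp
  linear_combination h

/-- if m is a small unit, cancel it in divisibility -/
theorem dvd_cancel {m : ℕ} (h1 : p.Coprime m) {a x : ℤ_[p]} (h : a ∣ m * x) : a ∣ x := by
  have : (m : ℤ_[p]) * (m : ℤ_[p]).inv = 1 := PadicInt.mul_inv (by rwa [PadicInt.norm_natCast_eq_one_iff])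
  obtain ⟨c, hc⟩ := h
  exact ⟨c * (m : ℤ_[p]).inv, by linear_combination (m : ℤ_[p]).inv * hc - x * this⟩

theorem bern_int {m : ℕ} (hm : m + 1 < p) : ((bernoulli m : ℚ) : ℚ_[p]) ∈ PadicInt.subring p := by
  induction m using Nat.strong_induction_on with
  | _ m ih =>
    have h := sum_bernoulli (m + 1)
    rw [Finset.sum_range_succ] at h
    have h' := congrArg (fun x : ℚ => (x : ℚ_[p])) h
    have hc := coe_r (p := p) (k := m + 1) (by omega) hm
    have h0 : ((m + 1 : ℕ) : ℚ_[p]) ≠ 0 := by exact_mod_cast Nat.succ_ne_zero m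
    have e : ((bernoulli m : ℚ) : ℚ_[p]) = (r p (m + 1) : ℚ_[p]) *
       ((if m + 1 = 1 then 1 else 0) - ∑ x ∈ range m, ((m + 1).choose x : ℚ_[p]) * ((bernoulli x : ℚ) : ℚ_[p])) := by
      rw [hc]
      have h2 : (∑ x ∈ range m, ((m + 1).choose x : ℚ_[p]) * ((bernoulli x : ℚ) : ℚ_[p])) + ((m + 1 : ℕ) : ℚ_[p]) * ((bernoulli m : ℚ) : ℚ_[p]) = (if m + 1 = 1 then 1 else 0) := by
        rw [Nat.choose_succ_self_right] at h'
        split_ifs at h' ⊢ <;> exact_mod_cast h'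
      field_simp
      linear_combination h2
    rw [e]
    refine mul_mem (r p (m+1)).2 (sub_mem ?_ (sum_mem fun x hx => mul_mem (natCast_mem _ _) (ih x ?_ ?_)))
    · split_ifs
      · exact one_mem _
      · exact zero_mem _
    · simpa using hx
    · simp at hx; omega

theorem power_sum (h5 : 5 ≤ p) : ∃ c : ℤ_[p],
    ((∑ k ∈ Icc 1 (p - 1), (k : ℤ_[p]) ^ (p - 3) : ℤ_[p]) : ℚ_[p]) =
      p * ((bernoulli (p - 3) : ℚ) : ℚ_[p]) + p ^ 2 * c := by
  obtain ⟨m, rfl⟩ : ∃ m, p = m + 3 := ⟨p - 3, by omega⟩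
  have h := congrArg (fun x : ℚ => (x : ℚ_[m + 3])) (sum_range_pow (m + 3) m)
  have hS : ∑ k ∈ range (m + 3), (k : ℚ) ^ m = ∑ k ∈ Icc 1 (m + 3 - 1), (k : ℚ) ^ m := by
    rw [Finset.sum_range_succ', Finset.range_eq_Ico, Finset.sum_Ico_add' (fun k : ℕ => (k : ℚ) ^ m) 0 (m + 2) 1]
    simp [show m ≠ 0 by omega]
    rfl
  rw [hS, Finset.sum_range_succ] at h
  have hc := coe_r (p := m + 3) (k := m + 1) (by omega) (by omega)
  have h0 : ((m + 1 : ℕ) : ℚ_[m + 3]) ≠ 0 := by exact_mod_cast Nat.succ_ne_zero m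
  have hmem : (∑ i ∈ range m, ((bernoulli i : ℚ) : ℚ_[m + 3]) * ((m + 1).choose i : ℚ_[m + 3]) *
      ((m + 3 : ℕ) : ℚ_[m + 3]) ^ (m - 1 - i) * (r (m + 3) (m + 1) : ℚ_[m + 3])) ∈ PadicInt.subring (m + 3) := by
    refine sum_mem fun i hi => mul_mem (mul_mem (mul_mem (bern_int ?_) (natCast_mem _ _)) (pow_mem (natCast_mem _ _) _)) (r (m+3) (m+1)).2
    simp at hi; omega
  refine ⟨⟨_, hmem⟩, ?_⟩
  rw [show m + 3 - 3 = m by omega]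
  simp only [PadicInt.coe_sum, PadicInt.coe_pow, PadicInt.coe_natCast]
  push_cast at h ⊢
  rw [h]
  refine (add_comm _ _).trans ?_
  congr 1
  · rw [Nat.choose_succ_self_right, show m + 1 - m = 1 by omega]
    push_cast at h0 ⊢
    field_simp
  · rw [Finset.mul_sum]
    refine Finset.sum_congr rfl fun i hi => ?_
    simp at hi
    rw [hc, show m + 1 - i = (m - 1 - i) + 2 by omega]
    push_cast
    ring


theorem r_double {k : ℕ} (h1 : 1 ≤ k) (h2 : 2 * k < p) : 2 * r p (2 * k) = r p k := by
  have a := mul_r (p := p) (k := k) h1 (by omega)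
  have b := mul_r (p := p) (k := 2 * k) (by omega) h2
  push_cast at b
  linear_combination (r p k) * b - 2 * r p (2 * k) * a

theorem r_reflect {k : ℕ} (h1 : 1 ≤ k) (h2 : k < p) :
    ∃ c, r p (p - k) = - r p k - p * (r p k) ^ 2 + p ^ 2 * c := by
  have a := mul_r (p := p) (k := k) h1 h2
  have b := mul_r (p := p) (k := p - k) (by omega) (by omega)
  rw [Nat.cast_sub h2.le] at b
  refine ⟨r p (p - k) * (r p k) ^ 2, ?_⟩
  generalize r p k = x at *
  generalize r p (p - k) = y at *
  linear_combination (-x - p * x ^ 2) * b - (y + p * x * y) * a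

theorem fermat {k : ℕ} (h1 : 1 ≤ k) (h2 : k < p) : ∃ c : ℤ_[p], (k : ℤ_[p]) ^ (p - 1) = 1 + p * c := by
  have h : (p : ℤ) ∣ (k : ℤ) ^ (p - 1) - 1 := by
    have := (Int.ModEq.pow_card_sub_one_eq_one hp.out (n := k) (by
      rw [Nat.isCoprime_iff_coprime]
      exact (Nat.coprime_of_lt_prime (by omega) h2 hp.out).symm))
    exact this.symm.dvd
  obtain ⟨c, hc⟩ := h
  refine ⟨c, ?_⟩
  have := congrArg (fun x : ℤ => (x : ℤ_[p])) hc
  push_cast at this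
  linear_combination this

theorem prod_identity {n : ℕ} (hn : p = 2 * n + 1) :
    ∏ i ∈ Icc 1 n, (1 - (p : ℤ_[p]) * r p i) = 2 ^ (p - 1) * ∏ i ∈ Icc 1 n, (1 - (p : ℤ_[p]) * r p (2 * i)) := by
  have h := (prod_reflect n (fun k => (k : ℤ_[p]))).symm.trans (prod_parity n (fun k => (k : ℤ_[p])))
  have e1 : ∏ i ∈ Icc 1 n, ((i : ℤ_[p]) * ((2 * n + 1 - i : ℕ) : ℤ_[p])) =
      (∏ i ∈ Icc 1 n, (- (i : ℤ_[p]) ^ 2)) * ∏ i ∈ Icc 1 n, (1 - (p : ℤ_[p]) * r p i) := by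
    rw [← Finset.prod_mul_distrib]
    refine Finset.prod_congr rfl fun i hi => ?_
    simp only [mem_Icc] at hi
    rw [← hn, Nat.cast_sub (by omega)]
    have a := mul_r (p := p) (k := i) (by omega) (by omega)
    linear_combination (-p * i : ℤ_[p]) * a
  have e2 : ∏ i ∈ Icc 1 n, (((2 * i : ℕ) : ℤ_[p]) * ((2 * n + 1 - 2 * i : ℕ) : ℤ_[p])) =
      (∏ i ∈ Icc 1 n, (- (i : ℤ_[p]) ^ 2)) * (2 ^ (p - 1) * ∏ i ∈ Icc 1 n, (1 - (p : ℤ_[p]) * r p (2 * i))) := by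
    have e4 : (2 : ℤ_[p]) ^ (p - 1) = ∏ i ∈ Icc 1 n, 4 := by
      rw [Finset.prod_const, show p - 1 = 2 * n by omega, Nat.card_Icc]
      simp only [Nat.add_sub_cancel]
      rw [pow_mul]; norm_num
    rw [e4, ← Finset.prod_mul_distrib, ← Finset.prod_mul_distrib]
    refine Finset.prod_congr rfl fun i hi => ?_
    simp only [mem_Icc] at hi
    rw [← hn, Nat.cast_sub (by omega)]
    have a := mul_r (p := p) (k := 2 * i) (by omega) (by omega)
    push_cast at a ⊢
    linear_combination (-p * 2 * i : ℤ_[p]) * a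
  rw [e1, e2] at h
  refine mul_left_cancel₀ ?_ h
  rw [Finset.prod_ne_zero_iff]
  intro i hi
  simp only [mem_Icc] at hi
  have : (i : ℤ_[p]) ≠ 0 := by exact_mod_cast (by omega : i ≠ 0)
  simpa using this

/-- six times the truncated logarithm of a product -/
theorem trunc_log (s : Finset ℕ) (a : ℕ → ℤ_[p]) : ∃ x c : ℤ_[p],
    ∏ i ∈ s, (1 - p * a i) = 1 + p * x ∧
    6 * (p * x) - 3 * (p * x) ^ 2 + 2 * (p * x) ^ 3 =
      - 6 * p * ∑ i ∈ s, a i - 3 * p ^ 2 * ∑ i ∈ s, a i ^ 2 - 2 * p ^ 3 * ∑ i ∈ s, a i ^ 3 + p ^ 4 * c := by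
  classical
  induction s using Finset.induction_on with
  | empty => exact ⟨0, 0, by simp, by simp⟩
  | insert k s hk ih =>
    obtain ⟨x, c, h1, h2⟩ := ih
    rw [Finset.prod_insert hk, Finset.sum_insert hk, Finset.sum_insert hk, Finset.sum_insert hk, h1]
    obtain ⟨d, hd⟩ := log_add (x : ℤ_[p]) (-a k) p
    exact ⟨x - a k - p * x * a k, c + d, by ring, by linear_combination hd + h2⟩

theorem choose_prod {j : ℕ} (hj : j < p) :
    ((p - 1).choose j : ℤ_[p]) = (-1) ^ j * ∏ i ∈ Icc 1 j, (1 - (p : ℤ_[p]) * r p i) := by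
  induction j with
  | zero => simp
  | succ j ih =>
    rw [Finset.prod_Icc_succ_top (by omega)]
    have h := congrArg (fun x : ℕ => (x : ℤ_[p])) (Nat.choose_succ_right_eq (p - 1) j)
    have a := mul_r (p := p) (k := j + 1) (by omega) hj
    rw [show p - 1 - j = p - (j + 1) by omega] at h
    push_cast [Nat.cast_sub hj.le] at h a
    rw [ih (by omega)] at h
    have h0 : ((j + 1 : ℕ) : ℤ_[p]) ≠ 0 := by exact_mod_cast Nat.succ_ne_zero j
    refine mul_right_cancel₀ h0 ?_
    push_cast
    rw [h]
    generalize ∏ i ∈ Icc 1 j, (1 - (p : ℤ_[p]) * r p i) = P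
    rw [pow_succ]
    linear_combination (-(-1) ^ j * P * p) * a

/-- nested reciprocal sums -/
noncomputable def E1 (p : ℕ) [Fact p.Prime] (j : ℕ) : ℤ_[p] := ∑ i ∈ Icc 1 j, r p i
/-- nested double reciprocal sums -/
noncomputable def E2 (p : ℕ) [Fact p.Prime] (j : ℕ) : ℤ_[p] := ∑ i ∈ Icc 1 j, r p i * E1 p (i - 1)

theorem prod_expand (j : ℕ) : ∃ c : ℤ_[p],
    ∏ i ∈ Icc 1 j, (1 - (p : ℤ_[p]) * r p i) = 1 - p * E1 p j + p ^ 2 * E2 p j + p ^ 3 * c := by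
  induction j with
  | zero => exact ⟨0, by simp [E1, E2]⟩
  | succ j ih =>
    obtain ⟨c, hc⟩ := ih
    refine ⟨c - r p (j + 1) * E2 p j - p * c * r p (j + 1), ?_⟩
    rw [Finset.prod_Icc_succ_top (by omega), hc]
    have a : E1 p (j + 1) = E1 p j + r p (j + 1) := by
      unfold E1; rw [Finset.sum_Icc_succ_top (by omega)]
    have b : E2 p (j + 1) = E2 p j + r p (j + 1) * E1 p j := by
      unfold E2; rw [Finset.sum_Icc_succ_top (by omega)]; rfl
    rw [a, b]; ring

theorem sum_combine {ι : Type*} (s : Finset ι) (f : ι → ℤ_[p]) (g : ι → ℤ_[p]) (a : ℤ_[p])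
    (h : ∀ i ∈ s, ∃ c, f i = g i + a * c) : ∃ c, ∑ i ∈ s, f i = ∑ i ∈ s, g i + a * c := by
  have : a ∣ ∑ i ∈ s, (f i - g i) := Finset.dvd_sum fun i hi => by
    obtain ⟨c, hc⟩ := h i hi
    exact ⟨c, by rw [hc]; ring⟩
  obtain ⟨c, hc⟩ := this
  rw [Finset.sum_sub_distrib] at hc
  exact ⟨c, by linear_combination hc⟩

/-- the binomial relation -/
theorem binom_relation {n : ℕ} (hn : p = 2 * n + 1) (q : ℤ_[p]) (hq : p * q = 2 ^ (p - 1) - 1) :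
    ∃ c : ℤ_[p], 2 * q = - ∑ i ∈ Icc 1 n, r p i + 2 * p * ∑ i ∈ Icc 1 n, r p (2 * i) * E1 p (2 * i - 1)
      - 2 * p ^ 2 * ∑ i ∈ Icc 1 n, r p (2 * i) * E2 p (2 * i - 1) + p ^ 3 * c := by
  have hp0 : (p : ℤ_[p]) ≠ 0 := by exact_mod_cast hp.out.ne_zero
  have h := congrArg (fun x : ℕ => (x : ℤ_[p])) (choose_even_sum n)
  push_cast at h
  rw [show 2 * n = p - 1 by omega, ] at h
  have key : ∀ i ∈ Icc 1 n, ∃ c, ((p.choose (2 * i) : ℕ) : ℤ_[p]) * 2 =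
     (p * (- r p i + 2 * p * (r p (2 * i) * E1 p (2 * i - 1)) - 2 * p ^ 2 * (r p (2 * i) * E2 p (2 * i - 1)))) + p ^ 4 * c := by
    intro i hi
    simp only [mem_Icc] at hi
    have a := mul_r (p := p) (k := 2 * i) (by omega) (by omega)
    have b := r_double (p := p) (k := i) (by omega) (by omega)
    obtain ⟨c, hc⟩ := prod_expand (p := p) (2 * i - 1)
    have d := choose_prod (p := p) (j := 2 * i - 1) (by omega)
    rw [hc, Odd.neg_one_pow (by rw [Nat.odd_iff]; omega)] at d
    have e := congrArg (fun x : ℕ => (x : ℤ_[p])) (Nat.add_one_mul_choose_eq (p - 1) (2 * i - 1))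
    simp only [Nat.sub_add_cancel (show 1 ≤ p by omega), Nat.sub_add_cancel (show 1 ≤ 2 * i by omega)] at e
    rw [Nat.cast_mul, Nat.cast_mul, d] at e
    refine ⟨- 2 * r p (2 * i) * c, ?_⟩
    linear_combination (-2 * r p (2 * i)) * e - 2 * (p.choose (2 * i) : ℤ_[p]) * a - p * b
  obtain ⟨c, hc⟩ := sum_combine _ _ _ _ key
  rw [← Finset.sum_mul, ← Finset.mul_sum, Finset.sum_sub_distrib, Finset.sum_add_distrib,
    Finset.sum_neg_distrib, ← Finset.mul_sum, ← Finset.mul_sum] at hc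
  rw [show p - 1 + 1 = p by omega] at h
  refine ⟨c, mul_left_cancel₀ hp0 ?_⟩
  linear_combination 2 * hq - 2 * h + hc

theorem log_relation {n : ℕ} (hn : p = 2 * n + 1) (q : ℤ_[p]) (hq : p * q = 2 ^ (p - 1) - 1) :
    ∃ c : ℤ_[p], 24 * q - 12 * p * q ^ 2 + 8 * p ^ 2 * q ^ 3 = -12 * ∑ i ∈ Icc 1 n, r p i
      - 9 * p * ∑ i ∈ Icc 1 n, r p i ^ 2 - 7 * p ^ 2 * ∑ i ∈ Icc 1 n, r p i ^ 3 + p ^ 3 * c := by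
  have hp0 : (p : ℤ_[p]) ≠ 0 := by exact_mod_cast hp.out.ne_zero
  obtain ⟨x, c, hx, hc⟩ := trunc_log (p := p) (Icc 1 n) (fun i => r p i)
  obtain ⟨y, d, hy, hd⟩ := trunc_log (p := p) (Icc 1 n) (fun i => r p (2 * i))
  have h := prod_identity hn
  rw [hx, hy, ← sub_eq_zero] at h
  have hxe : x = q + y + p * q * y := by
    refine mul_left_cancel₀ hp0 ?_
    linear_combination h - (1 + p * y) * hq
  obtain ⟨e, he⟩ := log_add q y (p : ℤ_[p])
  have s1 : ∑ i ∈ Icc 1 n, r p i = 2 * ∑ i ∈ Icc 1 n, r p (2 * i) := by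
    rw [Finset.mul_sum]; refine Finset.sum_congr rfl fun i hi => ?_
    simp only [mem_Icc] at hi
    rw [r_double (by omega) (by omega)]
  have s2 : ∑ i ∈ Icc 1 n, r p i ^ 2 = 4 * ∑ i ∈ Icc 1 n, r p (2 * i) ^ 2 := by
    rw [Finset.mul_sum]; refine Finset.sum_congr rfl fun i hi => ?_
    simp only [mem_Icc] at hi
    rw [← r_double (by omega) (by omega)]; ring
  have s3 : ∑ i ∈ Icc 1 n, r p i ^ 3 = 8 * ∑ i ∈ Icc 1 n, r p (2 * i) ^ 3 := by
    rw [Finset.mul_sum]; refine Finset.sum_congr rfl fun i hi => ?_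
    simp only [mem_Icc] at hi
    rw [← r_double (by omega) (by omega)]; ring
  refine ⟨4 * (c - d - e), mul_left_cancel₀ hp0 ?_⟩
  rw [hxe] at hc
  rw [s1, s2, s3] at hc ⊢
  linear_combination 4 * hc - 4 * hd - 4 * he

theorem sq_relation {n : ℕ} (hn : p = 2 * n + 1) :
    ∃ c : ℤ_[p], 6 * ∑ i ∈ Icc 1 n, r p i ^ 2 + 7 * p * ∑ i ∈ Icc 1 n, r p i ^ 3 = p ^ 2 * c := by
  have h := (sum_reflect n (fun k => r p k ^ 2)).symm.trans (sum_parity n (fun k => r p k ^ 2))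
  simp only [← hn] at h
  obtain ⟨c, hc⟩ := sum_combine (p := p) (Icc 1 n) (fun i => r p i ^ 2 + r p (p - i) ^ 2)
    (fun i => 2 * r p i ^ 2 + 2 * p * r p i ^ 3) (p ^ 2) (by
      intro i hi
      simp only [mem_Icc] at hi
      obtain ⟨c, hc⟩ := r_reflect (p := p) (k := i) (by omega) (by omega)
      rw [hc]
      exact ⟨r p i ^ 4 - 2 * r p i * c - 2 * p * r p i ^ 2 * c + p ^ 2 * c ^ 2, by ring⟩)
  obtain ⟨d, hd⟩ := sum_combine (p := p) (Icc 1 n) (fun i => 4 * (r p (2 * i) ^ 2 + r p (p - 2 * i) ^ 2))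
    (fun i => 2 * r p i ^ 2 + p * r p i ^ 3) (p ^ 2) (by
      intro i hi
      simp only [mem_Icc] at hi
      obtain ⟨c, hc⟩ := r_reflect (p := p) (k := 2 * i) (by omega) (by omega)
      rw [hc, ← r_double (p := p) (k := i) (by omega) (by omega)]
      generalize r p (2 * i) = x
      exact ⟨4 * (x ^ 4 - 2 * x * c - 2 * p * x ^ 2 * c + p ^ 2 * c ^ 2), by ring⟩)
  rw [← Finset.mul_sum] at hd
  rw [Finset.sum_add_distrib (f := fun i => 2 * r p i ^ 2), ← Finset.mul_sum, ← Finset.mul_sum] at hc hd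
  refine ⟨d - 4 * c, ?_⟩
  linear_combination 4 * h - 4 * hc + hd

theorem add_pow_aux (m : ℕ) (y z : ℤ_[p]) :
    ∃ c, (y + z) ^ (m + 1) = z ^ (m + 1) + (m + 1) * y * z ^ m + y ^ 2 * c := by
  induction m with
  | zero => exact ⟨0, by simp; ring⟩
  | succ m ih =>
    obtain ⟨c, hc⟩ := ih
    refine ⟨(m + 1) * z ^ m + c * (y + z), ?_⟩
    rw [pow_succ, hc]; push_cast; ring

theorem pow_reflect {k : ℕ} (h1 : 1 ≤ k) (h2 : k < p) (h5 : 5 ≤ p) (ho : Odd p) :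
    ∃ c : ℤ_[p], (k : ℤ_[p]) ^ (p - 3) + ((p - k : ℕ) : ℤ_[p]) ^ (p - 3) =
      2 * (k : ℤ_[p]) ^ (p - 3) + 3 * p * r p k ^ 3 + p ^ 2 * c := by
  obtain ⟨m, hm⟩ : ∃ m, p = m + 4 := ⟨p - 4, by omega⟩
  have hmo : Odd m := by rw [Nat.odd_iff] at *; omega
  have a := mul_r h1 h2
  obtain ⟨f, hf⟩ := fermat h1 h2
  rw [show p - 1 = m + 3 by omega] at hf
  rw [show p - 3 = m + 1 by omega, Nat.cast_sub h2.le, sub_eq_add_neg]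
  obtain ⟨c, hc⟩ := add_pow_aux (p := p) m p (-(k : ℤ_[p]))
  rw [hc, (hmo.add_one).neg_pow, hmo.neg_pow]
  have hmp : (m : ℤ_[p]) = p - 4 := by
    have := congrArg (fun x : ℕ => (x : ℤ_[p])) hm
    push_cast at this; linear_combination -this
  rw [hmp]
  have hk : (k : ℤ_[p]) ^ m = r p k ^ 3 + p * (f * r p k ^ 3) := by
    have a3 : (k : ℤ_[p]) ^ 3 * r p k ^ 3 = 1 := by rw [← mul_pow, a, one_pow]
    rw [pow_add] at hf
    linear_combination r p k ^ 3 * hf - (k : ℤ_[p]) ^ m * a3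
  refine ⟨c - r p k ^ 3 - p * (f * r p k ^ 3) + 3 * f * r p k ^ 3, ?_⟩
  linear_combination (3 * p - p ^ 2 : ℤ_[p]) * hk

theorem cube_relation {n : ℕ} (hn : p = 2 * n + 1) (h5 : 5 ≤ p) :
    ∃ c : ℤ_[p], p * ∑ i ∈ Icc 1 n, r p i ^ 3 + 2 * ∑ k ∈ Icc 1 (p - 1), (k : ℤ_[p]) ^ (p - 3) = p ^ 2 * c := by
  have ho : Odd p := ⟨n, hn⟩
  have h1 := sum_reflect n (fun k => (k : ℤ_[p]) ^ (p - 3))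
  have h2 := sum_parity n (fun k => (k : ℤ_[p]) ^ (p - 3))
  simp only [← hn] at h1 h2
  rw [show 2 * n = p - 1 by omega] at h1 h2
  obtain ⟨q, hq⟩ := fermat (p := p) (k := 2) (by omega) (by omega)
  obtain ⟨c, hc⟩ := sum_combine (p := p) (Icc 1 n) _
    (fun i => 2 * (i : ℤ_[p]) ^ (p - 3) + 3 * p * r p i ^ 3) (p ^ 2) (by
      intro i hi
      simp only [mem_Icc] at hi
      exact pow_reflect (p := p) (k := i) (by omega) (by omega) h5 ho)
  obtain ⟨d, hd⟩ := sum_combine (p := p) (Icc 1 n)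
    (fun i => 8 * (((2 * i : ℕ) : ℤ_[p]) ^ (p - 3) + ((p - 2 * i : ℕ) : ℤ_[p]) ^ (p - 3)))
    (fun i => 4 * (1 + p * q) * (i : ℤ_[p]) ^ (p - 3) + 3 * p * r p i ^ 3) (p ^ 2) (by
      intro i hi
      simp only [mem_Icc] at hi
      obtain ⟨c, hc⟩ := pow_reflect (p := p) (k := 2 * i) (by omega) (by omega) h5 ho
      rw [hc, ← r_double (p := p) (k := i) (by omega) (by omega), ← hq,
        show p - 1 = p - 3 + 2 by omega]
      push_cast
      rw [mul_pow, pow_add]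
      exact ⟨8 * c, by ring⟩)
  rw [← Finset.mul_sum, ← h2] at hd
  rw [← h1] at hc
  rw [Finset.sum_add_distrib, ← Finset.mul_sum, ← Finset.mul_sum] at hc hd
  generalize ∑ k ∈ Icc 1 (p - 1), (k : ℤ_[p]) ^ (p - 3) = s at *
  generalize ∑ i ∈ Icc 1 n, (i : ℤ_[p]) ^ (p - 3) = t at *
  generalize ∑ i ∈ Icc 1 n, r p i ^ 3 = H at *
  have c2 : p.Coprime 2 := (Nat.coprime_primes hp.out Nat.prime_two).2 (by omega)
  have c3 : p.Coprime 3 := (Nat.coprime_primes hp.out Nat.prime_three).2 (by omega)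
  have hs : (p : ℤ_[p]) ∣ s := by
    apply dvd_cancel (m := 2 * 3) (Nat.Coprime.mul_right c2 c3)
    refine ⟨2 * q * s - 3 * H + p * d - 2 * (1 + p * q) * p * c - 6 * p * q * H, ?_⟩
    push_cast
    linear_combination hd - 2 * (1 + p * q) * hc
  obtain ⟨s', rfl⟩ := hs
  have : (p : ℤ_[p]) ^ 2 ∣ p * H + 2 * (p * s') := by
    apply dvd_cancel c3
    refine ⟨2 * q * s' + d - 2 * (1 + p * q) * c - 6 * q * H, ?_⟩
    push_cast
    linear_combination hd - 2 * (1 + p * q) * hc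
  exact this

theorem padic_main {n : ℕ} (hn : p = 2 * n + 1) (h5 : 5 ≤ p) (q : ℤ_[p]) (hq : p * q = 2 ^ (p - 1) - 1) :
    (p : ℤ_[p]) ^ 2 ∣ 24 * (∑ i ∈ Icc 1 n, r p (2 * i) * E1 p (2 * i - 1)
      - p * ∑ i ∈ Icc 1 n, r p (2 * i) * E2 p (2 * i - 1)) - 12 * q ^ 2 + 8 * p * q ^ 3
      + 7 * ∑ k ∈ Icc 1 (p - 1), (k : ℤ_[p]) ^ (p - 3) := by
  have hp0 : (p : ℤ_[p]) ≠ 0 := by exact_mod_cast hp.out.ne_zero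
  obtain ⟨a, ha⟩ := binom_relation hn q hq
  obtain ⟨b, hb⟩ := log_relation hn q hq
  obtain ⟨c, hc⟩ := sq_relation hn
  obtain ⟨d, hd⟩ := cube_relation hn h5
  have c2 : p.Coprime 2 := (Nat.coprime_primes hp.out Nat.prime_two).2 (by omega)
  apply dvd_cancel c2
  refine ⟨2 * b - 24 * a - 3 * c + 7 * d, mul_left_cancel₀ hp0 ?_⟩
  push_cast
  linear_combination 2 * hb - 24 * ha - 3 * p * hc + 7 * p * hd

end
end DMT

open DMT
theorem double_minus_triple_sum (p : ℕ) [Fact p.Prime] (h5 : 5 ≤ p) :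
    ‖((((∑ k ∈ (Finset.Icc 1 (p - 1)).filter (fun k => Even k),
          ∑ j ∈ Finset.Icc 1 (k - 1), (1 : ℚ) / (j * k))
        - (p : ℚ) * (∑ k ∈ (Finset.Icc 1 (p - 1)).filter (fun k => Even k),
          ∑ j ∈ Finset.Icc 1 (k - 1), ∑ i ∈ Finset.Icc 1 (j - 1), (1 : ℚ) / (i * j * k))
        - ((1 / 2) * ((2 ^ (p - 1) - 1 : ℚ) / p) ^ 2
          - (1 / 3) * (p : ℚ) * ((2 ^ (p - 1) - 1 : ℚ) / p) ^ 3
          - (7 / 24) * (p : ℚ) * bernoulli (p - 3))) : ℚ) : ℚ_[p])‖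
      ≤ (p : ℝ) ^ (-(2 : ℤ)) := by
  have hp : p.Prime := Fact.out
  obtain ⟨n, hn⟩ : Odd p := hp.odd_of_ne_two (by omega)
  obtain ⟨q, hq⟩ := fermat (p := p) (k := 2) (by omega) (by omega)
  obtain ⟨c, hc⟩ := padic_main hn h5 q (by push_cast at hq; linear_combination -hq)
  obtain ⟨d, hd⟩ := power_sum h5
  have hp0 : (p : ℚ_[p]) ≠ 0 := by exact_mod_cast hp.ne_zero
  have hq' : ((2 : ℚ_[p]) ^ (p - 1) - 1) / p = q := by
    have := congrArg (fun x : ℤ_[p] => (x : ℚ_[p])) hq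
    simp only [PadicInt.coe_mul, PadicInt.coe_add, PadicInt.coe_pow, PadicInt.coe_one,
      PadicInt.coe_natCast] at this
    rw [Nat.cast_two] at this
    rw [this]; field_simp; ring
  have t2 : ((∑ i ∈ Icc 1 n, r p (2 * i) * E1 p (2 * i - 1) : ℤ_[p]) : ℚ_[p]) =
      ((∑ k ∈ (Finset.Icc 1 (p - 1)).filter (fun k => Even k),
          ∑ j ∈ Finset.Icc 1 (k - 1), (1 : ℚ) / (j * k) : ℚ) : ℚ_[p]) := by
    rw [show p - 1 = 2 * n by omega, sum_evens, PadicInt.coe_sum]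
    push_cast
    refine Finset.sum_congr rfl fun i hi => ?_
    simp only [mem_Icc] at hi
    rw [E1, PadicInt.coe_sum, Finset.mul_sum]
    refine Finset.sum_congr rfl fun j hj => ?_
    simp only [mem_Icc] at hj
    rw [coe_r (by omega) (by omega), coe_r (by omega) (by omega)]
    push_cast
    ring
  have t3 : ((∑ i ∈ Icc 1 n, r p (2 * i) * E2 p (2 * i - 1) : ℤ_[p]) : ℚ_[p]) =
      ((∑ k ∈ (Finset.Icc 1 (p - 1)).filter (fun k => Even k),
          ∑ j ∈ Finset.Icc 1 (k - 1), ∑ i ∈ Finset.Icc 1 (j - 1), (1 : ℚ) / (i * j * k) : ℚ) : ℚ_[p]) := by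
    rw [show p - 1 = 2 * n by omega, sum_evens, PadicInt.coe_sum]
    push_cast
    refine Finset.sum_congr rfl fun i hi => ?_
    simp only [mem_Icc] at hi
    rw [E2, PadicInt.coe_sum, Finset.mul_sum]
    refine Finset.sum_congr rfl fun j hj => ?_
    simp only [mem_Icc] at hj
    rw [E1, PadicInt.coe_mul, PadicInt.coe_sum, Finset.mul_sum, Finset.mul_sum]
    refine Finset.sum_congr rfl fun l hl => ?_
    simp only [mem_Icc] at hl
    rw [coe_r (by omega) (by omega), coe_r (by omega) (by omega), coe_r (by omega) (by omega)]
    push_cast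
    ring
  have c2 : p.Coprime 2 := (Nat.coprime_primes hp Nat.prime_two).2 (by omega)
  have c3 : p.Coprime 3 := (Nat.coprime_primes hp Nat.prime_three).2 (by omega)
  have c24 : p.Coprime 24 := (Nat.Coprime.mul_right (Nat.Coprime.pow_right 3 c2) c3 : p.Coprime (2 ^ 3 * 3))
  have hu : (24 : ℤ_[p]) * ((24 : ℕ) : ℤ_[p]).inv = 1 := by
    have := PadicInt.mul_inv (p := p) (z := ((24 : ℕ) : ℤ_[p])) (by rwa [PadicInt.norm_natCast_eq_one_iff])
    exact_mod_cast this
  generalize ((24 : ℕ) : ℤ_[p]).inv = u at hu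
  have hu' := congrArg (fun x : ℤ_[p] => (x : ℚ_[p])) hu
  have hc' := congrArg (fun x : ℤ_[p] => (x : ℚ_[p])) hc
  have h24 : ((24 : ℤ_[p]) : ℚ_[p]) = 24 := by norm_cast
  have h12 : ((12 : ℤ_[p]) : ℚ_[p]) = 12 := by norm_cast
  have h8 : ((8 : ℤ_[p]) : ℚ_[p]) = 8 := by norm_cast
  have h7 : ((7 : ℤ_[p]) : ℚ_[p]) = 7 := by norm_cast
  simp only [PadicInt.coe_mul, PadicInt.coe_add, PadicInt.coe_sub, PadicInt.coe_pow, PadicInt.coe_one,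
    PadicInt.coe_natCast, h24, h12, h8, h7] at hu' hc'
  rw [t2, t3, hd] at hc'
  rw [Rat.cast_sub, Rat.cast_sub, Rat.cast_mul]
  generalize ((∑ k ∈ (Finset.Icc 1 (p - 1)).filter (fun k => Even k),
          ∑ j ∈ Finset.Icc 1 (k - 1), (1 : ℚ) / (j * k) : ℚ) : ℚ_[p]) = X at *
  generalize ((∑ k ∈ (Finset.Icc 1 (p - 1)).filter (fun k => Even k),
          ∑ j ∈ Finset.Icc 1 (k - 1), ∑ i ∈ Finset.Icc 1 (j - 1), (1 : ℚ) / (i * j * k) : ℚ) : ℚ_[p]) = Y at *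
  push_cast
  rw [hq']
  have e : X - p * Y - (1 / 2 * (q : ℚ_[p]) ^ 2 - 1 / 3 * p * (q : ℚ_[p]) ^ 3 - 7 / 24 * p * ((bernoulli (p - 3) : ℚ) : ℚ_[p]))
      = ((p ^ 2 * (u * (c - 7 * d)) : ℤ_[p]) : ℚ_[p]) := by
    simp only [PadicInt.coe_mul, PadicInt.coe_sub, PadicInt.coe_pow, PadicInt.coe_natCast, h7]
    linear_combination (1 / 24 : ℚ_[p]) * hc' - (1 / 24 : ℚ_[p]) * (p ^ 2 * (c - 7 * d)) * hu'
  rw [e, ← PadicInt.norm_def]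
  exact (PadicInt.norm_le_pow_iff_mem_span_pow _ 2).2 (Ideal.mem_span_singleton.2 (Dvd.intro _ rfl))
end
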